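/- Let a, b ∈ ℝ and let m ≥ 1 be an integer. There exists a constant c > 0, depending only on a, b and m, such that for every smooth periodic function u : ℝ² → ℝ, |(A^{m+1}u, A^{m+1} f(u))| ≤ ‖A^{m+2}u‖² + c(‖A^{m+1}u‖² + ‖u‖^{2(2m+5)} + 1), where f(u) = (a+3)u − 4Au + b|∇u|² + u³. -/

import Mathlib

open MeasureTheory Real Filter

noncomputable section

/-- A function `u : ℝ² → ℝ` is smooth periodic if it is `C^∞` and `2π`-periodic
in each variable. -/
def SmoothPeriodic (u : ℝ × ℝ → ℝ) : Prop :=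
  ContDiff ℝ (⊤ : ℕ∞) u ∧ (∀ x y, u (x + 2 * Real.pi, y) = u (x, y)) ∧
    (∀ x y, u (x, y + 2 * Real.pi) = u (x, y))

/-- Partial derivative in the first variable. -/
def pdx (u : ℝ × ℝ → ℝ) : ℝ × ℝ → ℝ := fun p => fderiv ℝ u p (1, 0)

/-- Partial derivative in the second variable. -/
def pdy (u : ℝ × ℝ → ℝ) : ℝ × ℝ → ℝ := fun p => fderiv ℝ u p (0, 1)

/-- The fundamental domain `[0, 2π]²`. -/
def sq2 : Set (ℝ × ℝ) := Set.Icc (0 : ℝ) (2 * Real.pi) ×ˢ Set.Icc (0 : ℝ) (2 * Real.pi)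

/-- The `L²` inner product over `[0, 2π]²`. -/
def l2inner (u v : ℝ × ℝ → ℝ) : ℝ := ∫ p in sq2, u p * v p

/-- The `L²` norm over `[0, 2π]²`. -/
def l2norm (u : ℝ × ℝ → ℝ) : ℝ := Real.sqrt (∫ p in sq2, (u p) ^ 2)

/-- The `L^q` norm over `[0, 2π]²`. -/
def lpnorm (q : ℝ) (u : ℝ × ℝ → ℝ) : ℝ := (∫ p in sq2, |u p| ^ q) ^ (1 / q)

/-- The operator `A = -Δ + 1`. -/
def Aop (u : ℝ × ℝ → ℝ) : ℝ × ℝ → ℝ :=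
  fun p => -(pdx (pdx u) p + pdy (pdy u) p) + u p

/-- The pointwise dot product of gradients, `∇v ⋅ ∇w`. -/
def gradDot (v w : ℝ × ℝ → ℝ) : ℝ × ℝ → ℝ :=
  fun p => pdx v p * pdx w p + pdy v p * pdy w p

/-- The nonlinearity `f(u) = (a+3)u − 4Au + b|∇u|² + u³`. -/
def fNL (a b : ℝ) (u : ℝ × ℝ → ℝ) : ℝ × ℝ → ℝ :=
  fun p => (a + 3) * u p - 4 * Aop u p + b * gradDot u u p + (u p) ^ 3

open scoped ENNReal ComplexConjugate

/-- The exponential monomial `e^{i k ⋅ p}`. -/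
def expMonomial (k : ℤ × ℤ) (p : ℝ × ℝ) : ℂ :=
  Complex.exp (Complex.I * (k.1 * p.1 + k.2 * p.2))

/-- The (unnormalised) Fourier coefficient over the fundamental domain. -/
def fourierCoef (F : ℝ × ℝ → ℂ) (k : ℤ × ℤ) : ℂ :=
  ∫ p in sq2, conj (expMonomial k p) * F p

section Torus

local instance : MeasureSpace UnitAddCircle := ⟨AddCircle.haarAddCircle⟩

/-- The measurable section of the torus with values in `(0, 2π]²`. -/
def torusSection (t : UnitAddTorus (Fin 2)) : ℝ × ℝ :=
  (2 * π * (AddCircle.equivIoc 1 0 (t 0) : ℝ), 2 * π * (AddCircle.equivIoc 1 0 (t 1) : ℝ))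

theorem measurable_torusSection : Measurable torusSection := by
  have h : ∀ i : Fin 2, Measurable fun t : UnitAddTorus (Fin 2) =>
      2 * π * (AddCircle.equivIoc 1 0 (t i) : ℝ) := fun i =>
    ((measurable_subtype_coe.comp (AddCircle.measurableEquivIoc 1 0).measurable).comp
      (measurable_pi_apply i)).const_mul _
  exact (h 0).prodMk (h 1)

theorem torusSection_mem_sq2 (t : UnitAddTorus (Fin 2)) : torusSection t ∈ sq2 := by
  have h : ∀ i : Fin 2, 2 * π * (AddCircle.equivIoc 1 0 (t i) : ℝ) ∈ Set.Icc 0 (2 * π) := by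
    intro i
    have := (AddCircle.equivIoc 1 0 (t i)).2
    have hp := Real.pi_pos
    constructor
    · have := this.1; positivity
    · have := this.2; nlinarith
  exact ⟨h 0, h 1⟩

open scoped Pointwise in
theorem integral_comp_torusSection (H : ℝ × ℝ → ℂ) :
    ∫ t, H (torusSection t) = ((4 * π ^ 2 : ℝ) : ℂ)⁻¹ * ∫ p in sq2, H p := by
  have hp := Real.pi_pos
  rw [UnitAddTorus.integral_preimage _ (0 : Fin 2 → ℝ)]
  have h1 : ∫ x in {x : Fin 2 → ℝ | ∀ i, x i ∈ Set.Ioc ((0 : Fin 2 → ℝ) i) ((0 : Fin 2 → ℝ) i + 1)},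
      H (torusSection fun i => (x i : UnitAddCircle)) =
      ∫ x in (MeasurableEquiv.finTwoArrow (α := ℝ)) ⁻¹' (Set.Ioc 0 1 ×ˢ Set.Ioc 0 1),
        (fun q : ℝ × ℝ => H ((2 * π) • q)) (MeasurableEquiv.finTwoArrow x) := by
    have hs : {x : Fin 2 → ℝ | ∀ i, x i ∈ Set.Ioc ((0 : Fin 2 → ℝ) i) ((0 : Fin 2 → ℝ) i + 1)} =
        (MeasurableEquiv.finTwoArrow (α := ℝ)) ⁻¹' (Set.Ioc 0 1 ×ˢ Set.Ioc 0 1) := by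
      ext x
      simp [Fin.forall_fin_two, MeasurableEquiv.finTwoArrow]
    rw [hs]
    refine setIntegral_congr_fun ((measurableSet_Ioc.prod measurableSet_Ioc).preimage
      (MeasurableEquiv.measurable _)) fun x hx => ?_
    have hx' : x 0 ∈ Set.Ioc (0 : ℝ) (0 + 1) ∧ x 1 ∈ Set.Ioc (0 : ℝ) (0 + 1) := by
      simpa [MeasurableEquiv.finTwoArrow] using hx
    have e : ∀ y ∈ Set.Ioc (0 : ℝ) (0 + 1),
        (AddCircle.equivIoc 1 0 (y : UnitAddCircle) : ℝ) = y := fun y hy => by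
      exact congrArg Subtype.val ((AddCircle.equivIoc 1 0).apply_symm_apply ⟨y, hy⟩)
    simp only [torusSection, e _ hx'.1, e _ hx'.2]
    rfl
  rw [h1, (volume_preserving_finTwoArrow ℝ).setIntegral_preimage_emb
    (MeasurableEquiv.measurableEmbedding _) (fun q : ℝ × ℝ => H ((2 * π) • q)),
    Measure.setIntegral_comp_smul_of_pos _ _ _ (by positivity)]
  have h2 : (2 * π) • (Set.Ioc (0 : ℝ) 1 ×ˢ Set.Ioc (0 : ℝ) 1) =
      Set.Ioc 0 (2 * π) ×ˢ Set.Ioc 0 (2 * π) := by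
    rw [Set.smul_set_prod, LinearOrderedField.smul_Ioc (by positivity)]
    simp
  have h3 : (Set.Ioc 0 (2 * π) ×ˢ Set.Ioc 0 (2 * π) : Set (ℝ × ℝ)) =ᵐ[volume] sq2 :=
    Measure.set_prod_ae_eq Ioc_ae_eq_Icc Ioc_ae_eq_Icc
  rw [h2, setIntegral_congr_set h3, Module.finrank_prod, Module.finrank_self, Complex.real_smul]
  congr 1
  push_cast
  ring

theorem mFourierCoeff_comp_torusSection (F : ℝ × ℝ → ℂ) (k : ℤ × ℤ) :
    UnitAddTorus.mFourierCoeff (fun t => F (torusSection t)) ![k.1, k.2] =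
      ((4 * π ^ 2 : ℝ) : ℂ)⁻¹ * fourierCoef F k := by
  rw [fourierCoef, ← integral_comp_torusSection fun p => conj (expMonomial k p) * F p,
    UnitAddTorus.mFourierCoeff]
  congr 1
  ext t
  have h : ∀ (n : ℤ) (x : UnitAddCircle), fourier n x =
      Complex.exp (Complex.I * (n * (2 * π * (AddCircle.equivIoc 1 0 x : ℝ) : ℝ))) := by
    intro n x
    conv_lhs => rw [← (AddCircle.equivIoc 1 0).symm_apply_apply x]
    have : (AddCircle.equivIoc (1 : ℝ) 0).symm (AddCircle.equivIoc 1 0 x) =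
      ((AddCircle.equivIoc 1 0 x : ℝ) : UnitAddCircle) := rfl
    rw [this, fourier_coe_apply]
    congr 1
    push_cast
    ring
  rw [UnitAddTorus.mFourier_neg, smul_eq_mul]
  congr 2
  simp only [UnitAddTorus.mFourier, ContinuousMap.coe_mk, Fin.prod_univ_two, h, expMonomial,
    ← Complex.exp_add, torusSection]
  congr 1
  simp
  ring

theorem memLp_comp_torusSection {F : ℝ × ℝ → ℂ} (hF : Continuous F) :
    MemLp (fun t => F (torusSection t)) 2 := by
  have hc : IsCompact sq2 := isCompact_Icc.prod isCompact_Icc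
  obtain ⟨C, hC⟩ := hc.exists_bound_of_continuousOn hF.continuousOn
  have : IsProbabilityMeasure (volume : Measure UnitAddCircle) :=
    inferInstanceAs (IsProbabilityMeasure AddCircle.haarAddCircle)
  exact MemLp.of_bound (hF.measurable.comp measurable_torusSection).aestronglyMeasurable C
    (ae_of_all _ fun t => hC _ (torusSection_mem_sq2 t))

/-- **Parseval's identity** on `[0, 2π]²`. -/
theorem hasSum_conj_fourierCoef_mul {F G : ℝ × ℝ → ℂ} (hF : Continuous F) (hG : Continuous G) :
    HasSum (fun k => conj (fourierCoef F k) * fourierCoef G k)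
      (((4 * π ^ 2 : ℝ) : ℂ) * ∫ p in sq2, conj (F p) * G p) := by
  have hp := Real.pi_pos
  have hc : ∀ {F : ℝ × ℝ → ℂ} (hF : Continuous F) (n : Fin 2 → ℤ),
      UnitAddTorus.mFourierCoeff (memLp_comp_torusSection hF).toLp n =
        UnitAddTorus.mFourierCoeff (fun t => F (torusSection t)) n := fun hF n => by
    refine integral_congr_ae ?_
    filter_upwards [(memLp_comp_torusSection hF).coeFn_toLp] with t ht
    rw [ht]
  have h := UnitAddTorus.hasSum_prod_mFourierCoeff
    (memLp_comp_torusSection hF).toLp (memLp_comp_torusSection hG).toLp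
  have hi : ∫ t, conj ((memLp_comp_torusSection hF).toLp _ t) *
      (memLp_comp_torusSection hG).toLp _ t =
      ((4 * π ^ 2 : ℝ) : ℂ)⁻¹ * ∫ p in sq2, conj (F p) * G p := by
    rw [← integral_comp_torusSection fun p => conj (F p) * G p]
    refine integral_congr_ae ?_
    filter_upwards [(memLp_comp_torusSection hF).coeFn_toLp,
      (memLp_comp_torusSection hG).coeFn_toLp] with t ht ht'
    rw [ht, ht']
  rw [hi, ← (finTwoArrowEquiv ℤ).symm.hasSum_iff] at h
  have h' := h.mul_left (((4 * π ^ 2 : ℝ) : ℂ) ^ 2)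
  have hne : ((4 * π ^ 2 : ℝ) : ℂ) ≠ 0 := by
    exact_mod_cast (by positivity : (4 * π ^ 2 : ℝ) ≠ 0)
  convert! h' using 1
  · ext k
    rw [Function.comp_apply, finTwoArrowEquiv_symm_apply, hc hF, hc hG,
      mFourierCoeff_comp_torusSection, mFourierCoeff_comp_torusSection, map_mul, map_inv₀,
      Complex.conj_ofReal]
    field_simp
  · field_simp

end Torus

theorem SmoothPeriodic.continuous {u : ℝ × ℝ → ℝ} (hu : SmoothPeriodic u) : Continuous u :=
  hu.1.continuous

theorem SmoothPeriodic.add {u v : ℝ × ℝ → ℝ} (hu : SmoothPeriodic u) (hv : SmoothPeriodic v) :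
    SmoothPeriodic (fun p => u p + v p) :=
  ⟨hu.1.add hv.1, fun x y => by simp only [hu.2.1, hv.2.1],
    fun x y => by simp only [hu.2.2, hv.2.2]⟩

theorem SmoothPeriodic.mul {u v : ℝ × ℝ → ℝ} (hu : SmoothPeriodic u) (hv : SmoothPeriodic v) :
    SmoothPeriodic (fun p => u p * v p) :=
  ⟨hu.1.mul hv.1, fun x y => by simp only [hu.2.1, hv.2.1],
    fun x y => by simp only [hu.2.2, hv.2.2]⟩

theorem SmoothPeriodic.const_mul {u : ℝ × ℝ → ℝ} (hu : SmoothPeriodic u) (c : ℝ) :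
    SmoothPeriodic (fun p => c * u p) :=
  ⟨contDiff_const.mul hu.1, fun x y => by simp only [hu.2.1],
    fun x y => by simp only [hu.2.2]⟩

theorem SmoothPeriodic.fderiv_apply {u : ℝ × ℝ → ℝ} (hu : SmoothPeriodic u) (v : ℝ × ℝ) :
    SmoothPeriodic (fun p => fderiv ℝ u p v) := by
  have h : ∀ w : ℝ × ℝ, (∀ p, u (p + w) = u p) → ∀ p, fderiv ℝ u (p + w) v = fderiv ℝ u p v := by
    intro w hw p
    rw [← fderiv_comp_add_right, funext hw]
  refine ⟨(hu.1.fderiv_right (by simp)).clm_apply contDiff_const, fun x y => ?_, fun x y => ?_⟩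
  · simpa using h (2 * π, 0) (fun ⟨a, b⟩ => by simpa using hu.2.1 a b) (x, y)
  · simpa using h (0, 2 * π) (fun ⟨a, b⟩ => by simpa using hu.2.2 a b) (x, y)

theorem SmoothPeriodic.pdx {u : ℝ × ℝ → ℝ} (hu : SmoothPeriodic u) : SmoothPeriodic (pdx u) :=
  hu.fderiv_apply _

theorem SmoothPeriodic.pdy {u : ℝ × ℝ → ℝ} (hu : SmoothPeriodic u) : SmoothPeriodic (pdy u) :=
  hu.fderiv_apply _

theorem SmoothPeriodic.Aop {u : ℝ × ℝ → ℝ} (hu : SmoothPeriodic u) : SmoothPeriodic (Aop u) := by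
  have h := ((hu.pdx.pdx.add hu.pdy.pdy).const_mul (-1)).add hu
  convert! h using 1
  ext p
  simp [_root_.Aop]

theorem SmoothPeriodic.iterate_Aop {u : ℝ × ℝ → ℝ} (hu : SmoothPeriodic u) (n : ℕ) :
    SmoothPeriodic (_root_.Aop^[n] u) := by
  induction n with
  | zero => exact hu
  | succ n ih => rw [Function.iterate_succ_apply']; exact ih.Aop

theorem SmoothPeriodic.gradDot {u v : ℝ × ℝ → ℝ} (hu : SmoothPeriodic u)
    (hv : SmoothPeriodic v) : SmoothPeriodic (gradDot u v) :=
  (hu.pdx.mul hv.pdx).add (hu.pdy.mul hv.pdy)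

theorem SmoothPeriodic.fNL {u : ℝ × ℝ → ℝ} (hu : SmoothPeriodic u) (a b : ℝ) :
    SmoothPeriodic (fNL a b u) := by
  convert! (((hu.const_mul (a + 3)).add (hu.Aop.const_mul (-4))).add
    ((hu.gradDot hu).const_mul b)).add ((hu.mul hu).mul hu) using 1
  ext p
  simp only [_root_.fNL]
  ring

theorem integral_sq2_eq {H : ℝ × ℝ → ℂ} (hH : Continuous H) :
    ∫ p in sq2, H p = ∫ x in (0 : ℝ)..(2 * π), ∫ y in (0 : ℝ)..(2 * π), H (x, y) := by
  have hp : 0 ≤ 2 * π := by positivity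
  rw [sq2, Measure.volume_eq_prod, setIntegral_prod, intervalIntegral.integral_of_le hp,
    integral_Icc_eq_integral_Ioc]
  · simp_rw [intervalIntegral.integral_of_le hp, integral_Icc_eq_integral_Ioc]
  · exact hH.continuousOn.integrableOn_compact (isCompact_Icc.prod isCompact_Icc)

theorem integral_sq2_swap {H : ℝ × ℝ → ℂ} (hH : Continuous H) :
    ∫ p in sq2, H p = ∫ p in sq2, H p.swap := by
  rw [integral_sq2_eq hH, integral_sq2_eq (H := fun p => H p.swap) (hH.comp continuous_swap)]
  exact intervalIntegral_intervalIntegral_swap (F := fun x y => H (x, y))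
    ((hH.continuousOn.integrableOn_compact (isCompact_uIcc.prod isCompact_uIcc)).mono_set
      (Set.prod_mono Set.uIoc_subset_uIcc Set.uIoc_subset_uIcc))

/-- The integral over the fundamental domain of the `y`-derivative of a periodic function
vanishes. -/
theorem integral_sq2_deriv_snd_eq_zero {g g' : ℝ × ℝ → ℂ} (hg' : Continuous g')
    (h : ∀ x y, HasDerivAt (fun s => g (x, s)) (g' (x, y)) y)
    (hp : ∀ x y, g (x, y + 2 * π) = g (x, y)) : ∫ p in sq2, g' p = 0 := by
  rw [integral_sq2_eq hg']
  have : ∀ x, ∫ y in (0 : ℝ)..(2 * π), g' (x, y) = 0 := fun x => by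
    rw [intervalIntegral.integral_eq_sub_of_hasDerivAt (fun y _ => h x y)
      ((by fun_prop : Continuous fun y => g' (x, y)).intervalIntegrable _ _)]
    simpa [sub_eq_zero] using hp x 0
  simp [this]

theorem integral_sq2_deriv_fst_eq_zero {g g' : ℝ × ℝ → ℂ} (hg' : Continuous g')
    (h : ∀ x y, HasDerivAt (fun s => g (s, y)) (g' (x, y)) x)
    (hp : ∀ x y, g (x + 2 * π, y) = g (x, y)) : ∫ p in sq2, g' p = 0 := by
  rw [integral_sq2_swap hg']
  exact integral_sq2_deriv_snd_eq_zero (g := fun p => g p.swap) (hg'.comp continuous_swap)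
    (fun x y => h y x) (fun x y => hp y x)

/-- Fourier coefficients of a real function. -/
def realCoef (u : ℝ × ℝ → ℝ) (k : ℤ × ℤ) : ℂ := fourierCoef (fun p => (u p : ℂ)) k

theorem conj_expMonomial (k : ℤ × ℤ) (p : ℝ × ℝ) :
    conj (expMonomial k p) = Complex.exp (-(Complex.I * (k.1 * p.1 + k.2 * p.2))) := by
  rw [expMonomial, ← Complex.exp_conj]
  simp

theorem continuous_conj_expMonomial (k : ℤ × ℤ) : Continuous fun p => conj (expMonomial k p) := by
  simp_rw [conj_expMonomial]
  fun_prop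

theorem integrableOn_coef {u : ℝ × ℝ → ℝ} (hu : Continuous u) (k : ℤ × ℤ) :
    IntegrableOn (fun p => conj (expMonomial k p) * (u p : ℂ)) sq2 :=
  ((continuous_conj_expMonomial k).mul (Complex.continuous_ofReal.comp hu)).continuousOn
    |>.integrableOn_compact (isCompact_Icc.prod isCompact_Icc)

theorem realCoef_add {u v : ℝ × ℝ → ℝ} (hu : Continuous u) (hv : Continuous v) (k : ℤ × ℤ) :
    realCoef (fun p => u p + v p) k = realCoef u k + realCoef v k := by
  simp only [realCoef, fourierCoef]
  rw [← integral_add (integrableOn_coef hu k) (integrableOn_coef hv k)]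
  simp [mul_add]

theorem realCoef_const_mul (u : ℝ × ℝ → ℝ) (c : ℝ) (k : ℤ × ℤ) :
    realCoef (fun p => c * u p) k = c * realCoef u k := by
  simp only [realCoef, fourierCoef]
  rw [← integral_const_mul]
  congr 1
  ext p
  push_cast
  ring

theorem realCoef_pdx {u : ℝ × ℝ → ℝ} (hu : SmoothPeriodic u) (k : ℤ × ℤ) :
    realCoef (pdx u) k = Complex.I * k.1 * realCoef u k := by
  have hd : Differentiable ℝ u := hu.1.differentiable (by simp)
  have h0 := integral_sq2_deriv_fst_eq_zero
    (g := fun p => conj (expMonomial k p) * (u p : ℂ))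
    (g' := fun p => conj (expMonomial k p) * (pdx u p : ℂ) +
      -(Complex.I * k.1) * (conj (expMonomial k p) * (u p : ℂ)))
    (by
      have := continuous_conj_expMonomial k
      have := hu.continuous
      have := hu.pdx.continuous
      fun_prop)
    (fun x y => by
      have h1 : HasDerivAt (fun s => (u (s, y) : ℂ)) (pdx u (x, y) : ℂ) x :=
        ((hd (x, y)).hasFDerivAt.comp_hasDerivAt x
          ((hasDerivAt_id x).prodMk (hasDerivAt_const x y))).ofReal_comp
      have h2 : HasDerivAt (fun s : ℝ => conj (expMonomial k (s, y)))
          (-(Complex.I * k.1) * conj (expMonomial k (x, y))) x := by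
        simp_rw [conj_expMonomial]
        have := (((((Complex.ofRealCLM.hasDerivAt (x := x)).const_mul (k.1 : ℂ)).add_const
          (k.2 * y : ℂ)).const_mul Complex.I).neg).cexp
        convert! this using 1
        simp
        ring
      convert! h2.mul h1 using 1
      ring)
    (fun x y => by
      simp only [hu.2.1, conj_expMonomial]
      congr 1
      rw [Complex.exp_eq_exp_iff_exists_int]
      refine ⟨-k.1, ?_⟩
      push_cast
      ring)
  rw [integral_add (integrableOn_coef hu.pdx.continuous k)
    ((integrableOn_coef hu.continuous k).const_mul _), integral_const_mul] at h0
  simp only [realCoef, fourierCoef]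
  linear_combination h0

theorem realCoef_pdy {u : ℝ × ℝ → ℝ} (hu : SmoothPeriodic u) (k : ℤ × ℤ) :
    realCoef (pdy u) k = Complex.I * k.2 * realCoef u k := by
  have hd : Differentiable ℝ u := hu.1.differentiable (by simp)
  have h0 := integral_sq2_deriv_snd_eq_zero
    (g := fun p => conj (expMonomial k p) * (u p : ℂ))
    (g' := fun p => conj (expMonomial k p) * (pdy u p : ℂ) +
      -(Complex.I * k.2) * (conj (expMonomial k p) * (u p : ℂ)))
    (by
      have := continuous_conj_expMonomial k
      have := hu.continuous
      have := hu.pdy.continuous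
      fun_prop)
    (fun x y => by
      have h1 : HasDerivAt (fun s => (u (x, s) : ℂ)) (pdy u (x, y) : ℂ) y :=
        ((hd (x, y)).hasFDerivAt.comp_hasDerivAt y
          ((hasDerivAt_const y x).prodMk (hasDerivAt_id y))).ofReal_comp
      have h2 : HasDerivAt (fun s : ℝ => conj (expMonomial k (x, s)))
          (-(Complex.I * k.2) * conj (expMonomial k (x, y))) y := by
        simp_rw [conj_expMonomial]
        have := (((((Complex.ofRealCLM.hasDerivAt (x := y)).const_mul (k.2 : ℂ)).const_add
          (k.1 * x : ℂ)).const_mul Complex.I).neg).cexp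
        convert! this using 1
        simp
        ring
      convert! h2.mul h1 using 1
      ring)
    (fun x y => by
      simp only [hu.2.2, conj_expMonomial]
      congr 1
      rw [Complex.exp_eq_exp_iff_exists_int]
      refine ⟨-k.2, ?_⟩
      push_cast
      ring)
  rw [integral_add (integrableOn_coef hu.pdy.continuous k)
    ((integrableOn_coef hu.continuous k).const_mul _), integral_const_mul] at h0
  simp only [realCoef, fourierCoef]
  linear_combination h0

theorem realCoef_Aop {u : ℝ × ℝ → ℝ} (hu : SmoothPeriodic u) (k : ℤ × ℤ) :
    realCoef (Aop u) k = ((1 + k.1 ^ 2 + k.2 ^ 2 : ℝ) : ℂ) * realCoef u k := by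
  have : Aop u = fun p => (-1) * (pdx (pdx u) p + pdy (pdy u) p) + u p := by
    ext p
    simp [Aop]
  rw [this, realCoef_add ((hu.pdx.pdx.add hu.pdy.pdy).const_mul (-1)).continuous hu.continuous,
    realCoef_const_mul, realCoef_add hu.pdx.pdx.continuous hu.pdy.pdy.continuous,
    realCoef_pdx hu.pdx, realCoef_pdx hu, realCoef_pdy hu.pdy, realCoef_pdy hu]
  push_cast
  linear_combination (-(k.1 ^ 2 + k.2 ^ 2 : ℂ) * realCoef u k) * Complex.I_sq

theorem realCoef_iterate_Aop {u : ℝ × ℝ → ℝ} (hu : SmoothPeriodic u) (n : ℕ) (k : ℤ × ℤ) :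
    realCoef (Aop^[n] u) k = ((1 + k.1 ^ 2 + k.2 ^ 2 : ℝ) : ℂ) ^ n * realCoef u k := by
  induction n with
  | zero => simp
  | succ n ih =>
    rw [Function.iterate_succ_apply', realCoef_Aop (hu.iterate_Aop n), ih]
    ring

/-- **Parseval's identity** for real functions. -/
theorem hasSum_conj_realCoef_mul {u v : ℝ × ℝ → ℝ} (hu : Continuous u) (hv : Continuous v) :
    HasSum (fun k => conj (realCoef u k) * realCoef v k) ((4 * π ^ 2 * l2inner u v : ℝ) : ℂ) := by
  have h := hasSum_conj_fourierCoef_mul (Complex.continuous_ofReal.comp hu)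
    (Complex.continuous_ofReal.comp hv)
  convert! h using 1
  rw [l2inner, Complex.ofReal_mul, ← integral_complex_ofReal]
  simp

theorem hasSum_realCoef_mul_realCoef {u v : ℝ × ℝ → ℝ} (hu : Continuous u) (hv : Continuous v)
    (k : ℤ × ℤ) :
    HasSum (fun j => realCoef u j * realCoef v (k - j))
      (((4 * π ^ 2 : ℝ) : ℂ) * realCoef (fun p => u p * v p) k) := by
  have he : Continuous (expMonomial k) := by
    unfold expMonomial
    fun_prop
  have h := hasSum_conj_fourierCoef_mul (F := fun p => expMonomial k p * (v p : ℂ))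
    (G := fun p => (u p : ℂ)) (he.mul (Complex.continuous_ofReal.comp hv))
    (Complex.continuous_ofReal.comp hu)
  convert! h using 1
  · ext j
    rw [mul_comm, realCoef, realCoef]
    congr 1
    simp only [fourierCoef]
    rw [← integral_conj]
    congr 1
    ext p
    simp only [map_mul, Complex.conj_ofReal, Complex.conj_conj]
    rw [← mul_assoc, conj_expMonomial, conj_expMonomial, expMonomial, ← Complex.exp_add]
    congr 2
    simp
    ring
  · congr 1
    rw [realCoef, fourierCoef]
    congr 1
    ext p
    simp
    ring

open scoped NNReal

/-- The Cauchy–Schwarz inequality for sums in `ℝ≥0∞`. -/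
theorem tsum_mul_sq_le {ι : Type*} (f g : ι → ℝ≥0∞) :
    (∑' i, f i * g i) ^ 2 ≤ (∑' i, f i ^ 2) * ∑' i, g i ^ 2 := by
  let _ : MeasurableSpace ι := ⊤
  have h := ENNReal.lintegral_mul_le_Lp_mul_Lq Measure.count
    (Real.HolderConjugate.two_two) (f := f) (g := g)
    (measurable_from_top.aemeasurable) (measurable_from_top.aemeasurable)
  simp only [lintegral_count' measurable_from_top, Pi.mul_apply, ENNReal.rpow_two] at h
  calc _ ≤ ((∑' i, f i ^ 2) ^ (1 / 2 : ℝ) * (∑' i, g i ^ 2) ^ (1 / 2 : ℝ)) ^ 2 := by gcongr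
    _ = _ := by
      rw [mul_pow]
      simp only [← ENNReal.rpow_natCast, ← ENNReal.rpow_mul]
      norm_num

theorem tsum_mul_sq_le_tsum_sq_mul {ι : Type*} (f g : ι → ℝ≥0∞) :
    (∑' i, f i * g i) ^ 2 ≤ (∑' i, f i ^ 2 * g i) * ∑' i, g i := by
  have hs : ∀ x : ℝ≥0∞, (x ^ (1 / 2 : ℝ)) ^ 2 = x := fun x => by
    rw [← ENNReal.rpow_natCast, ← ENNReal.rpow_mul]
    norm_num
  have h := tsum_mul_sq_le (fun i => f i * g i ^ (1 / 2 : ℝ)) (fun i => g i ^ (1 / 2 : ℝ))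
  simpa only [mul_pow, hs, mul_assoc, ← sq] using h

theorem tsum_add_sq_le {ι : Type*} (f g : ι → ℝ≥0∞) :
    ∑' i, (f i + g i) ^ 2 ≤ 2 * (∑' i, f i ^ 2 + ∑' i, g i ^ 2) := by
  rw [← ENNReal.tsum_add, ← ENNReal.tsum_mul_left]
  refine ENNReal.tsum_le_tsum fun i => ?_
  have h := ENNReal.rpow_add_le_mul_rpow_add_rpow (f i) (g i) (p := 2) (by norm_num)
  norm_num at h
  exact h

section Convolution

variable {G : Type*} [AddCommGroup G]

/-- Convolution of sequences with values in `ℝ≥0∞`. -/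
def econv (f g : G → ℝ≥0∞) (k : G) : ℝ≥0∞ := ∑' j, f j * g (k - j)

theorem econv_mono {f f' g g' : G → ℝ≥0∞} (hf : ∀ k, f k ≤ f' k) (hg : ∀ k, g k ≤ g' k) (k : G) :
    econv f g k ≤ econv f' g' k :=
  ENNReal.tsum_le_tsum fun j => mul_le_mul' (hf j) (hg _)

theorem econv_comm (f g : G → ℝ≥0∞) : econv f g = econv g f := by
  ext k
  rw [econv, econv, ← (Equiv.subLeft k).tsum_eq]
  simp [mul_comm]

theorem econv_const_mul (c d : ℝ≥0∞) (f g : G → ℝ≥0∞) (k : G) :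
    econv (fun j => c * f j) (fun j => d * g j) k = c * d * econv f g k := by
  rw [econv, econv, ← ENNReal.tsum_mul_left]
  congr 1
  ext j
  ring

theorem tsum_econv (f g : G → ℝ≥0∞) : ∑' k, econv f g k = (∑' k, f k) * ∑' k, g k := by
  simp only [econv]
  rw [ENNReal.tsum_comm, ← ENNReal.tsum_mul_right]
  congr 1
  ext j
  rw [ENNReal.tsum_mul_left, ← (Equiv.subRight j).tsum_eq g]
  rfl

/-- **Young's inequality** `ℓ² * ℓ¹ ⊆ ℓ²`. -/
theorem tsum_econv_sq_le (f g : G → ℝ≥0∞) :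
    ∑' k, econv f g k ^ 2 ≤ (∑' k, f k ^ 2) * (∑' k, g k) ^ 2 := by
  have h : ∀ k, econv f g k ^ 2 ≤ econv (fun j => f j ^ 2) g k * ∑' j, g j := fun k => by
    refine (tsum_mul_sq_le_tsum_sq_mul f fun j => g (k - j)).trans_eq ?_
    rw [econv, ← (Equiv.subLeft k).tsum_eq g]
    rfl
  calc _ ≤ ∑' k, econv (fun j => f j ^ 2) g k * ∑' j, g j := ENNReal.tsum_le_tsum h
    _ = _ := by rw [ENNReal.tsum_mul_right, tsum_econv, mul_assoc, sq (∑' k, g k)]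

/-- A subadditive weight can be distributed over a convolution. -/
theorem pow_mul_econv_le {ρ : G → ℝ≥0∞} (hρ : ∀ j k, ρ k ≤ ρ j + ρ (k - j)) (n : ℕ)
    (f g : G → ℝ≥0∞) (k : G) :
    ρ k ^ n * econv f g k ≤
      2 ^ n * (econv (fun j => ρ j ^ n * f j) g k + econv f (fun j => ρ j ^ n * g j) k) := by
  simp only [econv]
  rw [← ENNReal.tsum_add, ← ENNReal.tsum_mul_left, ← ENNReal.tsum_mul_left]
  refine ENNReal.tsum_le_tsum fun j => ?_
  have h : ρ k ^ n ≤ 2 ^ n * (ρ j ^ n + ρ (k - j) ^ n) := by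
    have h1 : ρ k ≤ 2 * max (ρ j) (ρ (k - j)) := by
      rw [two_mul]
      exact (hρ j k).trans (add_le_add (le_max_left _ _) (le_max_right _ _))
    calc ρ k ^ n ≤ (2 * max (ρ j) (ρ (k - j))) ^ n := by gcongr
      _ = 2 ^ n * max (ρ j) (ρ (k - j)) ^ n := mul_pow _ _ _
      _ ≤ _ := by
        gcongr
        rcases max_choice (ρ j) (ρ (k - j)) with h | h <;> rw [h]
        · exact le_self_add
        · exact le_add_self
  calc ρ k ^ n * (f j * g (k - j)) ≤ 2 ^ n * (ρ j ^ n + ρ (k - j) ^ n) * (f j * g (k - j)) := by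
        gcongr
    _ = _ := by ring

end Convolution

/-- The weight `1 + |k₁| + |k₂|`. -/
def latticeWeight (k : ℤ × ℤ) : ℕ := 1 + k.1.natAbs + k.2.natAbs

theorem latticeWeight_le (j k : ℤ × ℤ) :
    (latticeWeight k : ℝ≥0∞) ≤ latticeWeight j + latticeWeight (k - j) := by
  have : latticeWeight k ≤ latticeWeight j + latticeWeight (k - j) := by
    simp only [latticeWeight, Prod.fst_sub, Prod.snd_sub]
    omega
  exact_mod_cast this

theorem sum_range_inv_le {r : ℝ} (hr : 0 < r) (n : ℕ) :
    ∑ i ∈ Finset.range n, (1 + ((i + 1 : ℝ) / r) ^ 2)⁻¹ ≤ 2 * r * (1 - (1 + n / r)⁻¹) := by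
  induction n with
  | zero => simp
  | succ n ih =>
    rw [Finset.sum_range_succ]
    have h : (1 + ((n + 1 : ℝ) / r) ^ 2)⁻¹ ≤
        2 * r * ((1 + n / r)⁻¹ - (1 + (n + 1 : ℝ) / r)⁻¹) := by
      have e : 2 * r * ((1 + n / r)⁻¹ - (1 + (n + 1 : ℝ) / r)⁻¹) =
          2 / ((1 + n / r) * (1 + (n + 1) / r)) := by
        have : 0 < r + n := by positivity
        have : 0 < r + (n + 1) := by positivity
        field_simp
        ring
      rw [e, inv_eq_one_div, div_le_div_iff₀ (by positivity) (by positivity)]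
      have h1 : (n : ℝ) / r ≤ (n + 1) / r := by gcongr; linarith
      have h2 : 0 ≤ (n : ℝ) / r := by positivity
      nlinarith [sq_nonneg ((n + 1 : ℝ) / r - 1)]
    push_cast
    linarith

theorem tsum_int_inv_le {r : ℝ≥0} (hr : 1 ≤ r) :
    ∑' n : ℤ, (((1 + ((n.natAbs : ℝ≥0) / r) ^ 2)⁻¹ : ℝ≥0) : ℝ≥0∞) ≤ 5 * r := by
  have h0 : ∑' n : ℕ, (((1 + ((n + 1 : ℝ≥0) / r) ^ 2)⁻¹ : ℝ≥0) : ℝ≥0∞) ≤ 2 * r := by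
    refine ENNReal.tsum_le_of_sum_range_le fun n => ?_
    have h := sum_range_inv_le (r := r) (by positivity) n
    have h' : 2 * (r : ℝ) * (1 - (1 + n / (r : ℝ))⁻¹) ≤ 2 * r := by
      have : 0 ≤ (1 + n / (r : ℝ))⁻¹ := by positivity
      have : 0 ≤ (r : ℝ) := r.2
      nlinarith
    exact_mod_cast h.trans h'
  rw [tsum_of_add_one_of_neg_add_one (f := fun n : ℤ =>
    (((1 + ((n.natAbs : ℝ≥0) / r) ^ 2)⁻¹ : ℝ≥0) : ℝ≥0∞)) ENNReal.summable ENNReal.summable]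
  have e1 : ∀ n : ℕ, ((((n : ℤ) + 1).natAbs : ℕ) : ℝ≥0) = n + 1 := fun n => by
    have : ((n : ℤ) + 1).natAbs = n + 1 := by omega
    rw [this]; push_cast; rfl
  have e2 : ∀ n : ℕ, ((-((n : ℤ) + 1)).natAbs : ℝ≥0) = n + 1 := fun n => by
    rw [Int.natAbs_neg, e1]
  simp only [e1, e2, Int.natAbs_zero]
  have h1 : (((1 + (((0 : ℕ) : ℝ≥0) / r) ^ 2)⁻¹ : ℝ≥0) : ℝ≥0∞) ≤ r := by
    simpa using hr
  calc _ ≤ 2 * (r : ℝ≥0∞) + r + 2 * r := by gcongr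
    _ = _ := by ring

theorem tsum_lattice_inv_sq_le {r : ℝ≥0} (hr : 1 ≤ r) :
    ∑' k : ℤ × ℤ, (((1 + ((latticeWeight k : ℝ≥0) / r) ^ 2)⁻¹ : ℝ≥0) : ℝ≥0∞) ^ 2 ≤
      (5 * r) ^ 2 := by
  have h : ∀ k : ℤ × ℤ, (((1 + ((latticeWeight k : ℝ≥0) / r) ^ 2)⁻¹ : ℝ≥0) : ℝ≥0∞) ^ 2 ≤
      (((1 + ((k.1.natAbs : ℝ≥0) / r) ^ 2)⁻¹ : ℝ≥0) : ℝ≥0∞) *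
        (((1 + ((k.2.natAbs : ℝ≥0) / r) ^ 2)⁻¹ : ℝ≥0) : ℝ≥0∞) := by
    intro k
    have h1 : k.1.natAbs ≤ latticeWeight k := by unfold latticeWeight; omega
    have h2 : k.2.natAbs ≤ latticeWeight k := by unfold latticeWeight; omega
    rw [sq]
    gcongr
  calc _ ≤ _ := ENNReal.tsum_le_tsum h
    _ = (∑' n : ℤ, (((1 + ((n.natAbs : ℝ≥0) / r) ^ 2)⁻¹ : ℝ≥0) : ℝ≥0∞)) ^ 2 := by
      rw [ENNReal.tsum_prod (f := fun m n : ℤ =>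
        (((1 + ((m.natAbs : ℝ≥0) / r) ^ 2)⁻¹ : ℝ≥0) : ℝ≥0∞) *
          (((1 + ((n.natAbs : ℝ≥0) / r) ^ 2)⁻¹ : ℝ≥0) : ℝ≥0∞))]
      simp only [ENNReal.tsum_mul_left, ENNReal.tsum_mul_right, sq]
    _ ≤ _ := by gcongr; exact tsum_int_inv_le hr

section Majorant

/-- The sequence `a` reweighted so as to control the frequencies above `r`. -/
def majorant (N : ℕ) (r : ℝ≥0) (a : ℤ × ℤ → ℝ≥0∞) (k : ℤ × ℤ) : ℝ≥0∞ :=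
  ((1 + ((latticeWeight k : ℝ≥0) / r) ^ N : ℝ≥0) : ℝ≥0∞) * a k

/-- The sequence `majorant N r a` with two powers of decay above frequency `r`. -/
def decayMajorant (N : ℕ) (r : ℝ≥0) (a : ℤ × ℤ → ℝ≥0∞) (k : ℤ × ℤ) : ℝ≥0∞ :=
  majorant N r a k * (((1 + ((latticeWeight k : ℝ≥0) / r) ^ 2)⁻¹ : ℝ≥0) : ℝ≥0∞)

theorem pow_le_one_add_pow (t : ℝ≥0) {s N : ℕ} (hs : s ≤ N) : t ^ s ≤ 1 + t ^ N := by
  rcases le_total t 1 with h | h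
  · exact (pow_le_one' h s).trans le_self_add
  · exact (pow_le_pow_right₀ h hs).trans le_add_self

theorem latticeWeight_pow_mul_le_majorant {N s : ℕ} (hs : s ≤ N) {r : ℝ≥0} (hr : 1 ≤ r)
    (a : ℤ × ℤ → ℝ≥0∞) (k : ℤ × ℤ) :
    (latticeWeight k : ℝ≥0∞) ^ s * a k ≤ (r : ℝ≥0∞) ^ s * majorant N r a k := by
  have hr0 : r ≠ 0 := (one_pos.trans_le hr).ne'
  have h : (latticeWeight k : ℝ≥0) ^ s ≤
      r ^ s * (1 + ((latticeWeight k : ℝ≥0) / r) ^ N) := by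
    calc (latticeWeight k : ℝ≥0) ^ s = r ^ s * ((latticeWeight k : ℝ≥0) / r) ^ s := by
          rw [← mul_pow, mul_div_cancel₀ _ hr0]
      _ ≤ _ := by gcongr; exact pow_le_one_add_pow _ hs
  rw [majorant, ← mul_assoc]
  gcongr
  exact_mod_cast h

theorem latticeWeight_pow_mul_le_decayMajorant {N s : ℕ} (hs : s + 2 ≤ N) {r : ℝ≥0} (hr : 1 ≤ r)
    (a : ℤ × ℤ → ℝ≥0∞) (k : ℤ × ℤ) :
    (latticeWeight k : ℝ≥0∞) ^ s * a k ≤ 2 * (r : ℝ≥0∞) ^ s * decayMajorant N r a k := by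
  have hr0 : r ≠ 0 := (one_pos.trans_le hr).ne'
  set t := (latticeWeight k : ℝ≥0) / r with ht
  have h : (latticeWeight k : ℝ≥0) ^ s ≤ 2 * r ^ s * ((1 + t ^ N) * (1 + t ^ 2)⁻¹) := by
    have h1 : t ^ s ≤ 2 * ((1 + t ^ N) * (1 + t ^ 2)⁻¹) := by
      rw [← mul_assoc, ← div_eq_mul_inv, le_div_iff₀ (by positivity)]
      calc t ^ s * (1 + t ^ 2) = t ^ s + t ^ (s + 2) := by ring
        _ ≤ (1 + t ^ N) + (1 + t ^ N) :=
          add_le_add (pow_le_one_add_pow _ (by omega)) (pow_le_one_add_pow _ hs)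
        _ = _ := by ring
    calc (latticeWeight k : ℝ≥0) ^ s = r ^ s * t ^ s := by
          rw [← mul_pow, ht, mul_div_cancel₀ _ hr0]
      _ ≤ r ^ s * (2 * ((1 + t ^ N) * (1 + t ^ 2)⁻¹)) := by gcongr
      _ = _ := by ring
  rw [decayMajorant, majorant, mul_right_comm _ (a k), ← mul_assoc]
  gcongr
  exact_mod_cast h

/-- A scale-invariant Agmon-type inequality on the Fourier side. -/
theorem tsum_decayMajorant_sq_le (N : ℕ) {r : ℝ≥0} (hr : 1 ≤ r) (a : ℤ × ℤ → ℝ≥0∞) :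
    (∑' k, decayMajorant N r a k) ^ 2 ≤ (5 * r) ^ 2 * ∑' k, majorant N r a k ^ 2 :=
  (tsum_mul_sq_le _ _).trans (by
    rw [mul_comm]
    gcongr
    exact tsum_lattice_inv_sq_le hr)

theorem tsum_majorant_sq_le (N : ℕ) {r : ℝ≥0} (hr : 1 ≤ r) (a : ℤ × ℤ → ℝ≥0∞) :
    (r : ℝ≥0∞) ^ (2 * N) * ∑' k, majorant N r a k ^ 2 ≤
      2 * (r ^ (2 * N) * ∑' k, a k ^ 2 + ∑' k, ((latticeWeight k : ℝ≥0∞) ^ N * a k) ^ 2) := by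
  have hr0 : r ≠ 0 := (one_pos.trans_le hr).ne'
  have h := tsum_add_sq_le (fun k => (r : ℝ≥0∞) ^ N * a k)
    (fun k => (latticeWeight k : ℝ≥0∞) ^ N * a k)
  simp only [mul_pow _ (a _), ENNReal.tsum_mul_left, ← pow_mul, mul_comm N 2] at h ⊢
  refine le_trans (le_of_eq ?_) h
  rw [← ENNReal.tsum_mul_left]
  congr 1
  ext k
  have e : ((1 + ((latticeWeight k : ℝ≥0) / r) ^ N : ℝ≥0) : ℝ≥0∞) * r ^ N =
      r ^ N + (latticeWeight k : ℝ≥0∞) ^ N := by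
    have : (1 + ((latticeWeight k : ℝ≥0) / r) ^ N) * r ^ N = r ^ N + (latticeWeight k : ℝ≥0) ^ N := by
      rw [add_mul, one_mul, ← mul_pow, div_mul_cancel₀ _ hr0]
    exact_mod_cast this
  rw [majorant, ← add_mul, ← e]
  ring

/-- Bound for the Fourier side of `Δ^m (∂u ∂u)`. -/
theorem tsum_quadratic_sq_le {m N : ℕ} (hN : 2 * m + 1 ≤ N) (hN' : 3 ≤ N) {r : ℝ≥0} (hr : 1 ≤ r)
    (a : ℤ × ℤ → ℝ≥0∞) :
    ∑' k, ((latticeWeight k : ℝ≥0∞) ^ (2 * m) *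
        econv (fun j => latticeWeight j * a j) (fun j => latticeWeight j * a j) k) ^ 2 ≤
      (2 ^ (2 * m + 2) * 5) ^ 2 * r ^ (4 * m + 6) * (∑' k, majorant N r a k ^ 2) ^ 2 := by
  have hb : ∀ k, (latticeWeight k : ℝ≥0∞) * a k ≤ 2 * r * decayMajorant N r a k := fun k => by
    simpa using latticeWeight_pow_mul_le_decayMajorant (s := 1) hN' hr a k
  have hh : ∀ k, (latticeWeight k : ℝ≥0∞) ^ (2 * m) * (latticeWeight k * a k) ≤
      r ^ (2 * m + 1) * majorant N r a k := fun k => by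
    rw [← mul_assoc, ← pow_succ]
    exact latticeWeight_pow_mul_le_majorant hN hr a k
  have hk : ∀ k, (latticeWeight k : ℝ≥0∞) ^ (2 * m) *
        econv (fun j => latticeWeight j * a j) (fun j => latticeWeight j * a j) k ≤
      2 ^ (2 * m + 2) * r ^ (2 * m + 2) *
        econv (majorant N r a) (decayMajorant N r a) k := fun k => by
    refine (pow_mul_econv_le latticeWeight_le _ _ _ k).trans ?_
    rw [econv_comm (fun j => (latticeWeight j : ℝ≥0∞) * a j), ← two_mul]
    calc _ ≤ 2 ^ (2 * m) * (2 * econv (fun j => (r : ℝ≥0∞) ^ (2 * m + 1) * majorant N r a j)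
          (fun j => 2 * r * decayMajorant N r a j) k) := by
          gcongr
          exact econv_mono hh hb k
      _ = _ := by
        rw [econv_const_mul]
        ring
  calc _ ≤ ∑' k, (2 ^ (2 * m + 2) * r ^ (2 * m + 2) *
        econv (majorant N r a) (decayMajorant N r a) k) ^ 2 :=
        ENNReal.tsum_le_tsum fun k => by gcongr ?_ ^ 2; exact hk k
    _ = (2 ^ (2 * m + 2) * r ^ (2 * m + 2)) ^ 2 *
        ∑' k, econv (majorant N r a) (decayMajorant N r a) k ^ 2 := by
      simp only [mul_pow _ (econv _ _ _), ENNReal.tsum_mul_left]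
    _ ≤ (2 ^ (2 * m + 2) * r ^ (2 * m + 2)) ^ 2 * ((∑' k, majorant N r a k ^ 2) *
        ((5 * r) ^ 2 * ∑' k, majorant N r a k ^ 2)) := by
      gcongr
      refine (tsum_econv_sq_le _ _).trans ?_
      gcongr
      exact tsum_decayMajorant_sq_le N hr a
    _ = _ := by ring

/-- Bound for the Fourier side of `Δ^m (u³)`. -/
theorem tsum_cubic_sq_le {m N : ℕ} (hN : 2 * m ≤ N) (hN' : 2 ≤ N) {r : ℝ≥0} (hr : 1 ≤ r)
    (a : ℤ × ℤ → ℝ≥0∞) :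
    ∑' k, ((latticeWeight k : ℝ≥0∞) ^ (2 * m) * econv (econv a a) a k) ^ 2 ≤
      (2 ^ (4 * m + 5) * 25) ^ 2 * r ^ (4 * m + 4) * (∑' k, majorant N r a k ^ 2) ^ 3 := by
  set h := majorant N r a
  set b := decayMajorant N r a
  have hb : ∀ k, a k ≤ 2 * b k := fun k => by
    simpa using latticeWeight_pow_mul_le_decayMajorant (s := 0) hN' hr a k
  have hh : ∀ k, (latticeWeight k : ℝ≥0∞) ^ (2 * m) * a k ≤ r ^ (2 * m) * h k :=
    latticeWeight_pow_mul_le_majorant hN hr a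
  have hbb : ∀ k, econv a a k ≤ 4 * econv b b k := fun k =>
    (econv_mono hb hb k).trans_eq (by rw [econv_const_mul]; norm_num)
  have hhb : ∀ k, (latticeWeight k : ℝ≥0∞) ^ (2 * m) * econv a a k ≤
      2 ^ (2 * m + 2) * r ^ (2 * m) * econv h b k := fun k => by
    refine (pow_mul_econv_le latticeWeight_le _ _ _ k).trans ?_
    rw [econv_comm a, ← two_mul]
    calc _ ≤ 2 ^ (2 * m) * (2 * econv (fun j => (r : ℝ≥0∞) ^ (2 * m) * h j)
          (fun j => 2 * b j) k) := by
          gcongr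
          exact econv_mono hh hb k
      _ = _ := by
        rw [econv_const_mul]
        ring
  have hk : ∀ k, (latticeWeight k : ℝ≥0∞) ^ (2 * m) * econv (econv a a) a k ≤
      2 ^ (4 * m + 3) * r ^ (2 * m) * (econv (econv h b) b k + econv h (econv b b) k) := fun k => by
    refine (pow_mul_econv_le latticeWeight_le _ _ _ k).trans ?_
    rw [econv_comm (econv a a) fun j => _]
    calc _ ≤ 2 ^ (2 * m) * (econv (fun j => 2 ^ (2 * m + 2) * r ^ (2 * m) * econv h b j)
            (fun j => 2 * b j) k +
          econv (fun j => (r : ℝ≥0∞) ^ (2 * m) * h j) (fun j => 4 * econv b b j) k) := by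
          gcongr
          · exact econv_mono hhb hb k
          · exact econv_mono hh hbb k
      _ = 2 ^ (2 * m) * (2 ^ (2 * m + 2) * r ^ (2 * m) * 2 * econv (econv h b) b k +
          r ^ (2 * m) * (1 * 4) * econv h (econv b b) k) := by
        rw [econv_const_mul, econv_const_mul]
        ring
      _ ≤ 2 ^ (2 * m) * (2 ^ (2 * m + 2) * r ^ (2 * m) * 2 * econv (econv h b) b k +
          r ^ (2 * m) * (2 ^ (2 * m + 1) * 4) * econv h (econv b b) k) := by
        gcongr
        exact one_le_pow₀ one_le_two
      _ = _ := by ring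
  have hl : (∑' k, b k) ^ 2 ≤ (5 * r) ^ 2 * ∑' k, h k ^ 2 := tsum_decayMajorant_sq_le N hr a
  have h1 : ∑' k, econv (econv h b) b k ^ 2 ≤ (∑' k, h k ^ 2) * ((∑' k, b k) ^ 2) ^ 2 :=
    (tsum_econv_sq_le _ _).trans (by
      calc _ ≤ ((∑' k, h k ^ 2) * (∑' k, b k) ^ 2) * (∑' k, b k) ^ 2 := by
            gcongr
            exact tsum_econv_sq_le _ _
        _ = _ := by ring)
  have h2 : ∑' k, econv h (econv b b) k ^ 2 ≤ (∑' k, h k ^ 2) * ((∑' k, b k) ^ 2) ^ 2 :=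
    (tsum_econv_sq_le _ _).trans_eq (by rw [tsum_econv]; ring)
  calc _ ≤ ∑' k, (2 ^ (4 * m + 3) * r ^ (2 * m) *
        (econv (econv h b) b k + econv h (econv b b) k)) ^ 2 :=
        ENNReal.tsum_le_tsum fun k => by gcongr ?_ ^ 2; exact hk k
    _ = (2 ^ (4 * m + 3) * r ^ (2 * m)) ^ 2 *
        ∑' k, (econv (econv h b) b k + econv h (econv b b) k) ^ 2 := by
      simp only [mul_pow _ (_ + _), ENNReal.tsum_mul_left]
    _ ≤ (2 ^ (4 * m + 3) * r ^ (2 * m)) ^ 2 *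
        (2 * ((∑' k, h k ^ 2) * ((5 * r) ^ 2 * ∑' k, h k ^ 2) ^ 2 +
          (∑' k, h k ^ 2) * ((5 * r) ^ 2 * ∑' k, h k ^ 2) ^ 2)) := by
      gcongr
      refine (tsum_add_sq_le _ _).trans ?_
      gcongr
      · exact h1.trans (by gcongr)
      · exact h2.trans (by gcongr)
    _ = (2 ^ (4 * m + 4) * 25) ^ 2 * r ^ (4 * m + 4) * (∑' k, h k ^ 2) ^ 3 := by ring
    _ ≤ _ := by
      gcongr
      · exact one_le_two
      · omega

end Majorant

section Estimate

/-- The symbol `1 + |k|²` of the operator `A`. -/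
def freqSymbol (k : ℤ × ℤ) : ℕ := 1 + k.1.natAbs ^ 2 + k.2.natAbs ^ 2

theorem freqSymbol_le (k : ℤ × ℤ) : freqSymbol k ≤ latticeWeight k ^ 2 := by
  simp only [freqSymbol, latticeWeight]
  nlinarith [Nat.zero_le (k.1.natAbs * k.2.natAbs), Nat.zero_le k.1.natAbs,
    Nat.zero_le k.2.natAbs]

theorem latticeWeight_sq_le (k : ℤ × ℤ) : latticeWeight k ^ 2 ≤ 3 * freqSymbol k := by
  simp only [freqSymbol, latticeWeight]
  zify
  nlinarith [sq_nonneg (|k.1| - 1), sq_nonneg (|k.2| - 1), sq_nonneg (|k.1| - |k.2|)]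

theorem one_le_freqSymbol (k : ℤ × ℤ) : (1 : ℝ≥0∞) ≤ freqSymbol k := by
  have : 1 ≤ freqSymbol k := by
    rw [freqSymbol]
    omega
  exact_mod_cast this

theorem enorm_realCoef_iterate_Aop {u : ℝ × ℝ → ℝ} (hu : SmoothPeriodic u) (n : ℕ) (k : ℤ × ℤ) :
    ‖realCoef (Aop^[n] u) k‖ₑ = (freqSymbol k : ℝ≥0∞) ^ n * ‖realCoef u k‖ₑ := by
  have h : ((1 + k.1 ^ 2 + k.2 ^ 2 : ℝ) : ℂ) = (freqSymbol k : ℂ) := by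
    have h1 : (k.1.natAbs : ℤ) ^ 2 = k.1 ^ 2 := Int.natAbs_sq _
    have h2 : (k.2.natAbs : ℤ) ^ 2 = k.2 ^ 2 := Int.natAbs_sq _
    rw [freqSymbol]
    norm_cast
    rw [← h1, ← h2]
    norm_cast
  rw [realCoef_iterate_Aop hu, h, enorm_mul, enorm_pow]
  congr 2
  simp [enorm_eq_nnnorm]

theorem sq_l2norm (u : ℝ × ℝ → ℝ) : l2norm u ^ 2 = l2inner u u := by
  rw [l2norm, Real.sq_sqrt (integral_nonneg fun p => sq_nonneg _), l2inner]
  simp only [sq]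

theorem l2norm_nonneg (u : ℝ × ℝ → ℝ) : 0 ≤ l2norm u := Real.sqrt_nonneg _

theorem tsum_enorm_realCoef_sq {u : ℝ × ℝ → ℝ} (hu : Continuous u) :
    ∑' k, ‖realCoef u k‖ₑ ^ 2 = ENNReal.ofReal (4 * π ^ 2) * ENNReal.ofReal (l2norm u) ^ 2 := by
  have h : HasSum (fun k => ‖realCoef u k‖ ^ 2) (4 * π ^ 2 * l2norm u ^ 2) := by
    rw [sq_l2norm, ← Complex.hasSum_ofReal]
    convert! hasSum_conj_realCoef_mul hu hu using 1
    ext k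
    rw [Complex.conj_mul']
    simp
  rw [← ENNReal.ofReal_pow (l2norm_nonneg u), ← ENNReal.ofReal_mul (by positivity), ← h.tsum_eq,
    ENNReal.ofReal_tsum_of_nonneg (fun k => by positivity) h.summable]
  congr 1
  ext k
  rw [ENNReal.ofReal_pow (norm_nonneg _), ofReal_norm]

theorem l2inner_Aop_right {u v : ℝ × ℝ → ℝ} (hu : SmoothPeriodic u)
    (hv : SmoothPeriodic v) : l2inner u (Aop v) = l2inner (Aop u) v := by
  have h1 := hasSum_conj_realCoef_mul hu.continuous hv.Aop.continuous
  have h2 := hasSum_conj_realCoef_mul hu.Aop.continuous hv.continuous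
  have h : ((4 * π ^ 2 * l2inner u (Aop v) : ℝ) : ℂ) = (4 * π ^ 2 * l2inner (Aop u) v : ℝ) := by
    refine h1.unique ?_
    convert! h2 using 1
    ext k
    rw [realCoef_Aop hu, realCoef_Aop hv, map_mul, Complex.conj_ofReal]
    ring
  exact mul_left_cancel₀ (by positivity) (Complex.ofReal_injective h)

theorem abs_l2inner_le {u v : ℝ × ℝ → ℝ} (hu : Continuous u) (hv : Continuous v) :
    |l2inner u v| ≤ l2norm u * l2norm v := by
  have hi : ∀ {w : ℝ × ℝ → ℝ}, Continuous w → IntegrableOn w sq2 := fun hw =>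
    hw.continuousOn.integrableOn_compact (isCompact_Icc.prod isCompact_Icc)
  have h : ∀ t : ℝ, 0 ≤ l2inner v v * (t * t) + 2 * l2inner u v * t + l2inner u u := fun t => by
    have : l2inner v v * (t * t) + 2 * l2inner u v * t + l2inner u u =
        ∫ p in sq2, (u p + t * v p) ^ 2 := by
      simp only [l2inner]
      rw [← integral_mul_const, ← integral_const_mul, ← integral_mul_const,
        ← integral_add (hi (by fun_prop)) (hi (by fun_prop)),
        ← integral_add (hi (by fun_prop)) (hi (by fun_prop))]
      congr 1
      ext p
      ring
    rw [this]
    exact integral_nonneg fun p => sq_nonneg _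
  have hd := discrim_le_zero h
  rw [discrim, ← sq_l2norm, ← sq_l2norm] at hd
  refine abs_le_of_sq_le_sq ?_ (mul_nonneg (l2norm_nonneg _) (l2norm_nonneg _))
  nlinarith

theorem enorm_realCoef_mul_le {u v : ℝ × ℝ → ℝ} (hu : Continuous u) (hv : Continuous v)
    (k : ℤ × ℤ) :
    ‖realCoef (fun p => u p * v p) k‖ₑ ≤
      econv (fun j => ‖realCoef u j‖ₑ) (fun j => ‖realCoef v j‖ₑ) k := by
  have h := hasSum_realCoef_mul_realCoef hu hv k
  have hL : (1 : ℝ≥0∞) ≤ ‖((4 * π ^ 2 : ℝ) : ℂ)‖ₑ := by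
    rw [← ofReal_norm, Complex.norm_real, Real.norm_of_nonneg (by positivity), ENNReal.one_le_ofReal]
    nlinarith [Real.pi_gt_three]
  calc _ ≤ ‖((4 * π ^ 2 : ℝ) : ℂ)‖ₑ * ‖realCoef (fun p => u p * v p) k‖ₑ := le_mul_of_one_le_left' hL
    _ = ‖∑' j, realCoef u j * realCoef v (k - j)‖ₑ := by rw [h.tsum_eq, enorm_mul]
    _ ≤ ∑' j, ‖realCoef u j * realCoef v (k - j)‖ₑ := enorm_tsum_le_tsum_enorm
    _ = _ := by simp only [enorm_mul, econv]

theorem l2inner_iterate_Aop_succ {u v : ℝ × ℝ → ℝ} (hu : SmoothPeriodic u)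
    (hv : SmoothPeriodic v) (m : ℕ) :
    l2inner (Aop^[m + 1] u) (Aop^[m + 1] v) = l2inner (Aop^[m + 2] u) (Aop^[m] v) := by
  rw [Function.iterate_succ_apply' _ m v, l2inner_Aop_right (hu.iterate_Aop _) (hv.iterate_Aop _),
    ← Function.iterate_succ_apply' Aop]

theorem enorm_realCoef_gradDot_le {u : ℝ × ℝ → ℝ} (hu : SmoothPeriodic u) (k : ℤ × ℤ) :
    ‖realCoef (gradDot u u) k‖ₑ ≤
      2 * econv (fun j => latticeWeight j * ‖realCoef u j‖ₑ)
        (fun j => latticeWeight j * ‖realCoef u j‖ₑ) k := by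
  have hn : ∀ (n : ℤ), ‖(n : ℂ)‖ₑ = (n.natAbs : ℝ≥0∞) := fun n => by
    rw [← ofReal_norm, Complex.norm_intCast, ← Int.cast_abs, ← Nat.cast_natAbs,
      ENNReal.ofReal_natCast]
  have hx : ∀ j, ‖realCoef (pdx u) j‖ₑ ≤ latticeWeight j * ‖realCoef u j‖ₑ := fun j => by
    rw [realCoef_pdx hu, enorm_mul, enorm_mul, hn, ← ofReal_norm Complex.I, Complex.norm_I,
      ENNReal.ofReal_one, one_mul]
    gcongr
    rw [latticeWeight]
    omega
  have hy : ∀ j, ‖realCoef (pdy u) j‖ₑ ≤ latticeWeight j * ‖realCoef u j‖ₑ := fun j => by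
    rw [realCoef_pdy hu, enorm_mul, enorm_mul, hn, ← ofReal_norm Complex.I, Complex.norm_I,
      ENNReal.ofReal_one, one_mul]
    gcongr
    rw [latticeWeight]
    omega
  have h := realCoef_add (hu.pdx.mul hu.pdx).continuous (hu.pdy.mul hu.pdy).continuous k
  calc ‖realCoef (gradDot u u) k‖ₑ = _ := congrArg _ h
    _ ≤ _ := enorm_add_le _ _
    _ ≤ _ := add_le_add
      ((enorm_realCoef_mul_le hu.pdx.continuous hu.pdx.continuous k).trans (econv_mono hx hx k))
      ((enorm_realCoef_mul_le hu.pdy.continuous hu.pdy.continuous k).trans (econv_mono hy hy k))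
    _ = _ := (two_mul _).symm

theorem enorm_realCoef_cube_le {u : ℝ × ℝ → ℝ} (hu : Continuous u) (k : ℤ × ℤ) :
    ‖realCoef (fun p => u p ^ 3) k‖ₑ ≤
      econv (econv (fun j => ‖realCoef u j‖ₑ) (fun j => ‖realCoef u j‖ₑ))
        (fun j => ‖realCoef u j‖ₑ) k := by
  simp only [pow_succ, pow_zero, one_mul]
  exact (enorm_realCoef_mul_le (hu.mul hu) hu k).trans
    (econv_mono (enorm_realCoef_mul_le hu hu) (fun _ => le_rfl) k)

theorem enorm_realCoef_fNL_le (a b : ℝ) {u : ℝ × ℝ → ℝ} (hu : SmoothPeriodic u) (k : ℤ × ℤ) :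
    ‖realCoef (fNL a b u) k‖ₑ ≤ (‖a + 3‖ₑ + 4) * (freqSymbol k * ‖realCoef u k‖ₑ) +
      (‖b‖ₑ * ‖realCoef (gradDot u u) k‖ₑ + ‖realCoef (fun p => u p ^ 3) k‖ₑ) := by
  have hr : ∀ c : ℝ, ‖(c : ℂ)‖ₑ = ‖c‖ₑ := fun c => by
    rw [← ofReal_norm, Complex.norm_real, ofReal_norm]
  have hc : SmoothPeriodic fun p => u p ^ 3 := by
    simpa only [pow_succ, pow_zero, one_mul] using (hu.mul hu).mul hu
  have h1 := (hu.const_mul (a + 3)).add (hu.Aop.const_mul (-4))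
  have h2 := h1.add ((hu.gradDot hu).const_mul b)
  have he : fNL a b u = fun p => (((a + 3) * u p + -4 * Aop u p) + b * gradDot u u p) + u p ^ 3 := by
    ext p
    rw [fNL]
    ring
  have hA : ‖realCoef (Aop u) k‖ₑ = freqSymbol k * ‖realCoef u k‖ₑ := by
    simpa using enorm_realCoef_iterate_Aop hu 1 k
  have h4 : ‖(-4 : ℝ)‖ₑ = 4 := by
    rw [enorm_neg, ← ofReal_norm]
    norm_num
  rw [he, realCoef_add h2.continuous hc.continuous,
    realCoef_add h1.continuous ((hu.gradDot hu).const_mul b).continuous,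
    realCoef_add (hu.const_mul _).continuous (hu.Aop.const_mul _).continuous,
    realCoef_const_mul, realCoef_const_mul, realCoef_const_mul]
  calc _ ≤ ‖((a + 3 : ℝ) : ℂ) * realCoef u k‖ₑ + ‖((-4 : ℝ) : ℂ) * realCoef (Aop u) k‖ₑ +
        ‖(b : ℂ) * realCoef (gradDot u u) k‖ₑ + ‖realCoef (fun p => u p ^ 3) k‖ₑ := by
        refine (enorm_add_le _ _).trans ?_
        gcongr
        refine (enorm_add_le _ _).trans ?_
        gcongr
        exact enorm_add_le _ _
    _ = ‖a + 3‖ₑ * (1 * ‖realCoef u k‖ₑ) + 4 * (freqSymbol k * ‖realCoef u k‖ₑ) +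
        ‖b‖ₑ * ‖realCoef (gradDot u u) k‖ₑ + ‖realCoef (fun p => u p ^ 3) k‖ₑ := by
        rw [enorm_mul, enorm_mul, enorm_mul, hr, hr, hr, h4, hA, one_mul]
    _ ≤ ‖a + 3‖ₑ * (freqSymbol k * ‖realCoef u k‖ₑ) + 4 * (freqSymbol k * ‖realCoef u k‖ₑ) +
        ‖b‖ₑ * ‖realCoef (gradDot u u) k‖ₑ + ‖realCoef (fun p => u p ^ 3) k‖ₑ := by
        gcongr
        exact one_le_freqSymbol k
    _ = _ := by ring

theorem l2norm_le_l2norm_iterate_Aop {u : ℝ × ℝ → ℝ} (hu : SmoothPeriodic u) (n : ℕ) :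
    l2norm u ≤ l2norm (Aop^[n] u) := by
  have h : ∑' k, ‖realCoef u k‖ₑ ^ 2 ≤ ∑' k, ‖realCoef (Aop^[n] u) k‖ₑ ^ 2 := by
    refine ENNReal.tsum_le_tsum fun k => ?_
    rw [enorm_realCoef_iterate_Aop hu]
    gcongr
    exact le_mul_of_one_le_left' (one_le_pow₀ (one_le_freqSymbol k))
  rw [tsum_enorm_realCoef_sq hu.continuous, tsum_enorm_realCoef_sq (hu.iterate_Aop n).continuous,
    ENNReal.mul_le_mul_iff_right (by simp [Real.pi_ne_zero]) ENNReal.ofReal_ne_top,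
    ENNReal.pow_le_pow_left_iff two_ne_zero,
    ENNReal.ofReal_le_ofReal_iff (l2norm_nonneg _)] at h
  exact h

theorem l2norm_iterate_Aop_eq_zero {u : ℝ × ℝ → ℝ} (hu : SmoothPeriodic u) (n : ℕ)
    (h : l2norm u = 0) : l2norm (Aop^[n] u) = 0 := by
  have h0 := tsum_enorm_realCoef_sq hu.continuous
  have hn := tsum_enorm_realCoef_sq (hu.iterate_Aop n).continuous
  have hz : ∀ k, realCoef u k = 0 := by
    simpa [h] using h0
  simp only [enorm_realCoef_iterate_Aop hu, hz, enorm_zero, mul_zero] at hn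
  have : ENNReal.ofReal (l2norm (Aop^[n] u)) = 0 := by
    refine pow_eq_zero_iff two_ne_zero |>.mp ((mul_eq_zero.mp (?_ : ENNReal.ofReal (4 * π ^ 2) *
      ENNReal.ofReal (l2norm (Aop^[n] u)) ^ 2 = 0)).resolve_left (by simp [Real.pi_ne_zero]))
    simpa using hn.symm
  exact (ENNReal.ofReal_eq_zero.mp this).antisymm (l2norm_nonneg _)

/-- The ratio between the norms of `Aop^[n] u` and `u` is a power of a frequency `r ≥ 1`. -/
theorem exists_frequency {u : ℝ × ℝ → ℝ} (hu : SmoothPeriodic u) (n : ℕ) {N : ℕ} (hN : N ≠ 0) :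
    ∃ r : ℝ≥0, 1 ≤ r ∧ l2norm (Aop^[n] u) = l2norm u * r ^ N := by
  rcases (l2norm_nonneg u).eq_or_lt' with h | h
  · exact ⟨1, le_rfl, by rw [h, l2norm_iterate_Aop_eq_zero hu n h, zero_mul]⟩
  · have hq : 1 ≤ l2norm (Aop^[n] u) / l2norm u :=
      (one_le_div h).mpr (l2norm_le_l2norm_iterate_Aop hu n)
    refine ⟨((l2norm (Aop^[n] u) / l2norm u) ^ (N⁻¹ : ℝ)).toNNReal,
      Real.one_le_toNNReal.mpr (Real.one_le_rpow hq (by positivity)), ?_⟩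
    rw [Real.coe_toNNReal _ (by positivity), Real.rpow_inv_natCast_pow (by positivity) hN,
      mul_div_cancel₀ _ h.ne']

theorem tsum_majorant_realCoef_sq_le {u : ℝ × ℝ → ℝ} (hu : SmoothPeriodic u) {n : ℕ} {r : ℝ≥0}
    (hr : 1 ≤ r) (hX : l2norm (Aop^[n] u) = l2norm u * r ^ (2 * n)) :
    ∑' k, majorant (2 * n) r (fun k => ‖realCoef u k‖ₑ) k ^ 2 ≤
      2 * (1 + 3 ^ (2 * n)) * ENNReal.ofReal (4 * π ^ 2) * ENNReal.ofReal (l2norm u) ^ 2 := by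
  have hw : ∑' k, ((latticeWeight k : ℝ≥0∞) ^ (2 * n) * ‖realCoef u k‖ₑ) ^ 2 ≤
      3 ^ (2 * n) * ∑' k, ‖realCoef (Aop^[n] u) k‖ₑ ^ 2 := by
    rw [← ENNReal.tsum_mul_left]
    refine ENNReal.tsum_le_tsum fun k => ?_
    have h : (latticeWeight k : ℝ≥0∞) ^ 2 ≤ 3 * freqSymbol k := by
      exact_mod_cast latticeWeight_sq_le k
    rw [enorm_realCoef_iterate_Aop hu]
    calc _ ≤ ((3 * freqSymbol k : ℝ≥0∞) ^ n * ‖realCoef u k‖ₑ) ^ 2 := by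
          rw [pow_mul]
          gcongr
      _ = _ := by ring
  have h := tsum_majorant_sq_le (2 * n) hr fun k => ‖realCoef u k‖ₑ
  rw [tsum_enorm_realCoef_sq (hu.iterate_Aop n).continuous, hX,
    ENNReal.ofReal_mul (l2norm_nonneg u), ENNReal.ofReal_pow r.coe_nonneg] at hw
  rw [tsum_enorm_realCoef_sq hu.continuous] at h
  have hr0 : (r : ℝ≥0∞) ≠ 0 := by exact_mod_cast (one_pos.trans_le hr).ne'
  rw [← ENNReal.mul_le_mul_iff_right (a := (r : ℝ≥0∞) ^ (2 * (2 * n))) (pow_ne_zero _ hr0)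
    (ENNReal.pow_ne_top ENNReal.coe_ne_top)]
  refine h.trans ?_
  calc _ ≤ _ := mul_le_mul_right (add_le_add_right hw _) 2
    _ = _ := by
      simp only [ENNReal.ofReal_coe_nnreal]
      ring

theorem ofReal_sq_l2norm_le {u : ℝ × ℝ → ℝ} (hu : Continuous u) :
    ENNReal.ofReal (l2norm u) ^ 2 ≤ ∑' k, ‖realCoef u k‖ₑ ^ 2 := by
  rw [tsum_enorm_realCoef_sq hu]
  refine le_mul_of_one_le_left' (ENNReal.one_le_ofReal.mpr ?_)
  nlinarith [Real.pi_gt_three]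

theorem exists_ofReal_sq_l2norm_fNL_le (a b : ℝ) (m : ℕ) :
    ∃ C : ℝ≥0, ∀ u, SmoothPeriodic u → ∀ r : ℝ≥0, 1 ≤ r →
      l2norm (Aop^[m + 2] u) = l2norm u * r ^ (2 * (m + 2)) →
      ENNReal.ofReal (l2norm (Aop^[m] (fNL a b u))) ^ 2 ≤
        C * (ENNReal.ofReal (l2norm (Aop^[m + 1] u)) ^ 2 +
          ENNReal.ofReal (l2norm u) ^ 4 * r ^ (4 * m + 6) +
          ENNReal.ofReal (l2norm u) ^ 6 * r ^ (4 * m + 4)) := by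
  set L := ENNReal.ofReal (4 * π ^ 2) with hL
  set α := ‖a + 3‖ₑ + 4 with hα
  set β := ‖b‖ₑ * 2 with hβ
  set K : ℝ≥0∞ := 2 * (1 + 3 ^ (2 * (m + 2))) * L with hK
  set C₁ := 2 * (α ^ 2 * L) with hC₁
  set C₂ := 2 * (2 * (β ^ 2 * ((2 ^ (2 * m + 2) * 5) ^ 2 * K ^ 2))) with hC₂
  set C₃ := 2 * (2 * ((2 ^ (4 * m + 5) * 25) ^ 2 * K ^ 3)) with hC₃
  have hC : C₁ + C₂ + C₃ ≠ ⊤ := by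
    finiteness
  obtain ⟨C, hC⟩ : ∃ C : ℝ≥0, (C : ℝ≥0∞) = C₁ + C₂ + C₃ := ⟨_, ENNReal.coe_toNNReal hC⟩
  refine ⟨C, fun u hu r hr hX => ?_⟩
  set e := ENNReal.ofReal (l2norm u)
  set y := ENNReal.ofReal (l2norm (Aop^[m + 1] u))
  set c := fun k => ‖realCoef u k‖ₑ with hc
  set Q := econv (fun j => latticeWeight j * c j) (fun j => latticeWeight j * c j)
  set T := econv (econv c c) c
  have hS : ∑' k, majorant (2 * (m + 2)) r c k ^ 2 ≤ K * e ^ 2 :=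
    tsum_majorant_realCoef_sq_le hu hr hX
  have hY : ∑' k, ‖realCoef (Aop^[m + 1] u) k‖ₑ ^ 2 = L * y ^ 2 :=
    tsum_enorm_realCoef_sq (hu.iterate_Aop _).continuous
  have hQ : ∑' k, ((latticeWeight k : ℝ≥0∞) ^ (2 * m) * Q k) ^ 2 ≤
      (2 ^ (2 * m + 2) * 5) ^ 2 * r ^ (4 * m + 6) * (K * e ^ 2) ^ 2 :=
    (tsum_quadratic_sq_le (N := 2 * (m + 2)) (by omega) (by omega) hr c).trans (by gcongr)
  have hT : ∑' k, ((latticeWeight k : ℝ≥0∞) ^ (2 * m) * T k) ^ 2 ≤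
      (2 ^ (4 * m + 5) * 25) ^ 2 * r ^ (4 * m + 4) * (K * e ^ 2) ^ 3 :=
    (tsum_cubic_sq_le (N := 2 * (m + 2)) (by omega) (by omega) hr c).trans (by gcongr)
  have hf : ∀ k, ‖realCoef (Aop^[m] (fNL a b u)) k‖ₑ ≤ α * ‖realCoef (Aop^[m + 1] u) k‖ₑ +
      (β * ((latticeWeight k : ℝ≥0∞) ^ (2 * m) * Q k) +
        (latticeWeight k : ℝ≥0∞) ^ (2 * m) * T k) := fun k => by
    have hw : (freqSymbol k : ℝ≥0∞) ^ m ≤ (latticeWeight k : ℝ≥0∞) ^ (2 * m) := by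
      rw [pow_mul]
      gcongr
      exact_mod_cast freqSymbol_le k
    rw [enorm_realCoef_iterate_Aop (hu.fNL a b), enorm_realCoef_iterate_Aop hu]
    calc _ ≤ (freqSymbol k : ℝ≥0∞) ^ m * (α * (freqSymbol k * c k) + (‖b‖ₑ * (2 * Q k) + T k)) := by
          gcongr
          refine (enorm_realCoef_fNL_le a b hu k).trans ?_
          gcongr
          · exact enorm_realCoef_gradDot_le hu k
          · exact enorm_realCoef_cube_le hu.continuous k
      _ = α * ((freqSymbol k : ℝ≥0∞) ^ (m + 1) * c k) + (β * ((freqSymbol k : ℝ≥0∞) ^ m * Q k) +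
          (freqSymbol k : ℝ≥0∞) ^ m * T k) := by
          rw [hβ]
          ring
      _ ≤ _ := by gcongr
  calc _ ≤ ∑' k, ‖realCoef (Aop^[m] (fNL a b u)) k‖ₑ ^ 2 :=
        ofReal_sq_l2norm_le ((hu.fNL a b).iterate_Aop m).continuous
    _ ≤ ∑' k, (α * ‖realCoef (Aop^[m + 1] u) k‖ₑ +
        (β * ((latticeWeight k : ℝ≥0∞) ^ (2 * m) * Q k) +
          (latticeWeight k : ℝ≥0∞) ^ (2 * m) * T k)) ^ 2 :=
        ENNReal.tsum_le_tsum fun k => by gcongr ?_ ^ 2; exact hf k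
    _ ≤ 2 * (∑' k, (α * ‖realCoef (Aop^[m + 1] u) k‖ₑ) ^ 2 +
        2 * (∑' k, (β * ((latticeWeight k : ℝ≥0∞) ^ (2 * m) * Q k)) ^ 2 +
          ∑' k, ((latticeWeight k : ℝ≥0∞) ^ (2 * m) * T k) ^ 2)) := by
        refine (tsum_add_sq_le _ _).trans ?_
        gcongr
        exact tsum_add_sq_le _ _
    _ = 2 * (α ^ 2 * ∑' k, ‖realCoef (Aop^[m + 1] u) k‖ₑ ^ 2 +
        2 * (β ^ 2 * ∑' k, ((latticeWeight k : ℝ≥0∞) ^ (2 * m) * Q k) ^ 2 +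
          ∑' k, ((latticeWeight k : ℝ≥0∞) ^ (2 * m) * T k) ^ 2)) := by
        simp only [mul_pow α, mul_pow β, ENNReal.tsum_mul_left]
    _ ≤ 2 * (α ^ 2 * (L * y ^ 2) +
        2 * (β ^ 2 * ((2 ^ (2 * m + 2) * 5) ^ 2 * r ^ (4 * m + 6) * (K * e ^ 2) ^ 2) +
          (2 ^ (4 * m + 5) * 25) ^ 2 * r ^ (4 * m + 4) * (K * e ^ 2) ^ 3)) := by
        rw [hY]
        gcongr
    _ = C₁ * y ^ 2 + C₂ * (e ^ 4 * r ^ (4 * m + 6)) + C₃ * (e ^ 6 * r ^ (4 * m + 4)) := by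
        rw [hC₁, hC₂, hC₃]
        ring
    _ ≤ (C₁ + C₂ + C₃) * y ^ 2 + (C₁ + C₂ + C₃) * (e ^ 4 * r ^ (4 * m + 6)) +
        (C₁ + C₂ + C₃) * (e ^ 6 * r ^ (4 * m + 4)) := by
        gcongr
        · exact le_add_right le_self_add
        · exact le_add_right le_add_self
        · exact le_add_self
    _ = _ := by
        rw [hC]
        ring

/-- Interpolation estimate for `Aop^[m] (fNL a b u)`, with `r` the ratio of norms of
`Aop^[m + 2] u` and `u`, normalized to a frequency. -/
theorem exists_sq_l2norm_fNL_le (a b : ℝ) (m : ℕ) :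
    ∃ C : ℝ, 0 ≤ C ∧ ∀ u, SmoothPeriodic u → ∃ r : ℝ,
      l2norm (Aop^[m + 2] u) = l2norm u * r ^ (2 * (m + 2)) ∧
      l2norm (Aop^[m] (fNL a b u)) ^ 2 ≤
        C * (l2norm (Aop^[m + 1] u) ^ 2 + l2norm u ^ 4 * r ^ (4 * m + 6) +
          l2norm u ^ 6 * r ^ (4 * m + 4)) := by
  obtain ⟨C, hC⟩ := exists_ofReal_sq_l2norm_fNL_le a b m
  refine ⟨C, C.coe_nonneg, fun u hu => ?_⟩
  obtain ⟨r, hr, hX⟩ := exists_frequency hu (m + 2) (N := 2 * (m + 2)) (by omega)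
  refine ⟨r, hX, ?_⟩
  have h := hC u hu r hr hX
  simp only [ENNReal.ofReal] at h
  norm_cast at h
  simpa [← NNReal.coe_le_coe, l2norm_nonneg] using h

theorem quadratic_absorb {C e r : ℝ} (hC : 0 ≤ C) (m : ℕ) :
    C * (e ^ 4 * r ^ (4 * m + 6)) ≤ (e * r ^ (2 * (m + 2))) ^ 2 / 2 +
      C * (2 * C) ^ (2 * m + 3) * e ^ (2 * (2 * m + 5)) := by
  rcases le_total (2 * C * e ^ 2) (r ^ 2) with h | h
  · have h1 : 2 * C * e ^ 2 * (e * r ^ (2 * m + 3)) ^ 2 ≤ r ^ 2 * (e * r ^ (2 * m + 3)) ^ 2 := by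
      gcongr
    have h2 : 0 ≤ C * (2 * C) ^ (2 * m + 3) * (e ^ (2 * m + 5)) ^ 2 := by positivity
    ring_nf at h1 h2 ⊢
    linarith
  · have h1 : C * e ^ 4 * (r ^ 2) ^ (2 * m + 3) ≤ C * e ^ 4 * (2 * C * e ^ 2) ^ (2 * m + 3) := by
      gcongr
    have h2 : 0 ≤ (e * r ^ (2 * (m + 2))) ^ 2 / 2 := by positivity
    calc _ = C * e ^ 4 * (r ^ 2) ^ (2 * m + 3) := by ring
      _ ≤ _ := h1
      _ = C * (2 * C) ^ (2 * m + 3) * e ^ (2 * (2 * m + 5)) := by ring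
      _ ≤ _ := le_add_of_nonneg_left h2

theorem cubic_absorb {C e r : ℝ} (hC : 0 ≤ C) (m : ℕ) :
    C * (e ^ 6 * r ^ (4 * m + 4)) ≤ (e * r ^ (2 * (m + 2))) ^ 2 / 2 +
      C * (2 * C) ^ (m + 1) * e ^ (2 * (2 * m + 5)) := by
  rcases le_total (2 * C * e ^ 4) (r ^ 4) with h | h
  · have h1 : 2 * C * e ^ 4 * (e * r ^ (2 * m + 2)) ^ 2 ≤ r ^ 4 * (e * r ^ (2 * m + 2)) ^ 2 := by
      gcongr
    have h2 : 0 ≤ C * (2 * C) ^ (m + 1) * (e ^ (2 * m + 5)) ^ 2 := by positivity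
    ring_nf at h1 h2 ⊢
    linarith
  · have h1 : C * e ^ 6 * (r ^ 4) ^ (m + 1) ≤ C * e ^ 6 * (2 * C * e ^ 4) ^ (m + 1) := by
      gcongr
    have h2 : 0 ≤ (e * r ^ (2 * (m + 2))) ^ 2 / 2 := by positivity
    calc _ = C * e ^ 6 * (r ^ 4) ^ (m + 1) := by ring
      _ ≤ _ := h1
      _ = C * (2 * C) ^ (m + 1) * e ^ (2 * (2 * m + 5)) := by ring
      _ ≤ _ := le_add_of_nonneg_left h2

end Estimate

/-- Estimate for `|(A^{m+1} u, A^{m+1} f(u))|`. -/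
theorem stmt_13 (a b : ℝ) (m : ℕ) (hm : 1 ≤ m) :
    ∃ c > 0, ∀ u : ℝ × ℝ → ℝ, SmoothPeriodic u →
      |l2inner (Aop^[m + 1] u) (Aop^[m + 1] (fNL a b u))| ≤
        l2norm (Aop^[m + 2] u) ^ 2 +
          c * (l2norm (Aop^[m + 1] u) ^ 2 + l2norm u ^ (2 * (2 * m + 5)) + 1) := by
  obtain ⟨C, hC, h⟩ := exists_sq_l2norm_fNL_le a b m
  set D := C * (2 * C) ^ (2 * m + 3) + C * (2 * C) ^ (m + 1) with hD
  have hD0 : 0 ≤ D := by positivity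
  refine ⟨C + D + 1, by positivity, fun u hu => ?_⟩
  obtain ⟨r, hX, hf⟩ := h u hu
  have hi := abs_l2inner_le (hu.iterate_Aop (m + 2)).continuous
    ((hu.fNL a b).iterate_Aop m).continuous
  rw [← l2inner_iterate_Aop_succ hu (hu.fNL a b)] at hi
  have h2 := quadratic_absorb (e := l2norm u) (r := r) hC m
  have h3 := cubic_absorb (e := l2norm u) (r := r) hC m
  rw [← hX] at h2 h3
  have hy := sq_nonneg (l2norm (Aop^[m + 1] u))
  have he : 0 ≤ l2norm u ^ (2 * (2 * m + 5)) := pow_nonneg (l2norm_nonneg u) _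
  generalize l2norm (Aop^[m] (fNL a b u)) = w at *
  generalize l2norm (Aop^[m + 1] u) ^ 2 = y at *
  generalize l2norm u ^ (2 * (2 * m + 5)) = z at *
  nlinarith [sq_nonneg (l2norm (Aop^[m + 2] u) - w), mul_nonneg hC hy, mul_nonneg hC he,
    mul_nonneg hD0 hy, mul_nonneg hD0 he]
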